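/- arXiv:2103.02989 — 11 statements merged into one kernel-verified Lean document; each statement's English description precedes it below -/
import Mathlib

section
/- Let Φ be a real-valued function on p×p real matrices that is concave on the set of positive semidefinite matrices and Löwner-increasing (Φ(A) ≤ Φ(B) whenever B − A is positive semidefinite). Then the map ξ ↦ Φ(L(ξ)) is concave on the convex set Ξ. -/
open Matrix

namespace Matrix

variable {m : Type*} [Fintype m] [DecidableEq m]

/-- The inverse is Löwner-convex on positive definite matrices. -/
theorem PosDef.posSemidef_inv_convex {A B : Matrix m m ℝ} (hA : A.PosDef) (hB : B.PosDef)
    {a b : ℝ} (ha : 0 ≤ a) (hb : 0 ≤ b) (hab : a + b = 1)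
    (hAB : (a • A + b • B).PosDef) :
    (a • A⁻¹ + b • B⁻¹ - (a • A + b • B)⁻¹).PosSemidef := by
  set S := a • A + b • B with hS
  have sq (X : Matrix m m ℝ) (hX : X.PosDef) :
      (S⁻¹ * X * S⁻¹ - (2 : ℝ) • S⁻¹ + X⁻¹).PosSemidef := by
    have hu : IsUnit X.det := X.isUnit_iff_isUnit_det.mp hX.isUnit
    have h := hX.posSemidef.conjTranspose_mul_mul_same (S⁻¹ - X⁻¹)
    rw [(hAB.inv.isHermitian.sub hX.inv.isHermitian).eq] at h
    convert h using 1
    simp only [sub_mul, mul_sub, nonsing_inv_mul _ hu, mul_nonsing_inv_cancel_right _ _ hu,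
      one_mul, two_smul]
    abel
  have h := ((sq A hA).smul ha).add ((sq B hB).smul hb)
  have hu : IsUnit S.det := S.isUnit_iff_isUnit_det.mp hAB.isUnit
  have key : a • (S⁻¹ * A * S⁻¹) + b • (S⁻¹ * B * S⁻¹) = S⁻¹ := by
    calc _ = S⁻¹ * S * S⁻¹ := by simp [hS, mul_add, add_mul]
      _ = S⁻¹ := by rw [nonsing_inv_mul _ hu, one_mul]
  convert h using 1
  calc a • A⁻¹ + b • B⁻¹ - S⁻¹ = a • A⁻¹ + b • B⁻¹ + S⁻¹ - (2 : ℝ) • ((a + b) • S⁻¹) := by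
        rw [hab]; module
    _ = a • A⁻¹ + b • B⁻¹ + (a • (S⁻¹ * A * S⁻¹) + b • (S⁻¹ * B * S⁻¹))
          - (2 : ℝ) • ((a + b) • S⁻¹) := by rw [key]
    _ = _ := by module

theorem PosDef.add_smul_inv {B D : Matrix m m ℝ} (hB : B.PosDef) (hD : D.PosSemidef)
    {c : ℝ} (hc : 0 < c) : (D + c • B⁻¹).PosDef :=
  (hB.inv.smul hc).posSemidef_add hD

theorem PosDef.mul_add_smul_one_inv_mul {B D : Matrix m m ℝ} (hB : B.PosDef)
    (hD : D.PosSemidef) {c : ℝ} (hc : 0 < c) :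
    (D * B + c • 1)⁻¹ * D = B⁻¹ - c • (B⁻¹ * (D + c • B⁻¹)⁻¹ * B⁻¹) := by
  have hu : IsUnit B.det := B.isUnit_iff_isUnit_det.mp hB.isUnit
  have hS := hB.add_smul_inv hD hc
  set S := D + c • B⁻¹ with hSdef
  have huS : IsUnit S.det := S.isUnit_iff_isUnit_det.mp hS.isUnit
  have hfac : D * B + c • 1 = S * B := by
    rw [hSdef, add_mul, smul_mul_assoc, nonsing_inv_mul _ hu]
  have hDS : D = S - c • B⁻¹ := by rw [hSdef, add_sub_cancel_right]
  rw [hfac, mul_inv_rev]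
  nth_rw 1 [hDS]
  rw [mul_sub, nonsing_inv_mul_cancel_right _ _ huS, mul_smul_comm]

theorem PosDef.posSemidef_mul_add_smul_one_inv_mul {B D : Matrix m m ℝ} (hB : B.PosDef)
    (hD : D.PosSemidef) {c : ℝ} (hc : 0 < c) :
    ((D * B + c • 1)⁻¹ * D).PosSemidef := by
  have hu : IsUnit B.det := B.isUnit_iff_isUnit_det.mp hB.isUnit
  have hS := hB.add_smul_inv hD hc
  have hfac : D * B + c • 1 = (D + c • B⁻¹) * B := by
    rw [add_mul, smul_mul_assoc, nonsing_inv_mul _ hu]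
  have huZ : IsUnit (D * B + c • 1).det := by
    rw [hfac, det_mul]
    exact ((isUnit_iff_isUnit_det _).mp hS.isUnit).mul hu
  set Z := D * B + c • 1 with hZ
  have hQ : (D * Zᴴ).PosSemidef := by
    have h := (hB.posSemidef.mul_mul_conjTranspose_same D).add (hD.smul hc.le)
    convert h using 1
    rw [hZ, conjTranspose_add, conjTranspose_mul, hB.isHermitian.eq, hD.isHermitian.eq,
      conjTranspose_smul, conjTranspose_one, mul_add, mul_smul_comm, mul_one, mul_assoc,
      star_trivial]
  convert hQ.mul_mul_conjTranspose_same Z⁻¹ using 1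
  have hZZ : Zᴴ * (Z⁻¹)ᴴ = 1 := by
    rw [← conjTranspose_mul, nonsing_inv_mul _ huZ, conjTranspose_one]
  rw [mul_assoc, mul_assoc D, hZZ, mul_one]

/-- The map `D ↦ (D * B + c • 1)⁻¹ * D` is Löwner-concave on positive semidefinite matrices. -/
theorem PosDef.posSemidef_mul_add_smul_one_inv_mul_concave {B D E : Matrix m m ℝ}
    (hB : B.PosDef) (hD : D.PosSemidef) (hE : E.PosSemidef) {c : ℝ} (hc : 0 < c)
    {a b : ℝ} (ha : 0 ≤ a) (hb : 0 ≤ b) (hab : a + b = 1) :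
    (((a • D + b • E) * B + c • 1)⁻¹ * (a • D + b • E)
      - (a • ((D * B + c • 1)⁻¹ * D) + b • ((E * B + c • 1)⁻¹ * E))).PosSemidef := by
  have hDE := (hD.smul ha).add (hE.smul hb)
  have hcomb : a • D + b • E + c • B⁻¹ = a • (D + c • B⁻¹) + b • (E + c • B⁻¹) := by
    calc _ = a • D + b • E + (a + b) • c • B⁻¹ := by rw [hab, one_smul]
      _ = _ := by module
  have hS := hB.add_smul_inv hDE hc
  rw [hB.mul_add_smul_one_inv_mul hD hc, hB.mul_add_smul_one_inv_mul hE hc,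
    hB.mul_add_smul_one_inv_mul hDE hc, hcomb]
  rw [hcomb] at hS
  have h := (((hB.add_smul_inv hD hc).posSemidef_inv_convex (hB.add_smul_inv hE hc)
    ha hb hab hS).conjTranspose_mul_mul_same B⁻¹).smul hc.le
  rw [hB.inv.isHermitian.eq] at h
  convert h using 1
  simp only [mul_sub, sub_mul, mul_add, add_mul, mul_smul_comm, smul_mul_assoc]
  obtain rfl : b = 1 - a := by linarith
  module

end Matrix

/-- **Theorem 1** (concavity of the virtual-noise design criterion).
If `Φ` is concave on positive semidefinite matrices and Löwner-increasing, then
`ξ ↦ Φ (L ξ)` is concave on the set `Ξ` of design measures, where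
`L ξ = Fᵀ (diagonal ξ (C - κ•I) + (κ/n)•I)⁻¹ diagonal ξ F`. -/
theorem stmt_0 (N n p : ℕ) (hN : 0 < N) (hn : 0 < n) (hp : 0 < p)
    (C : Matrix (Fin N) (Fin N) ℝ) (hC : C.PosDef)
    (κ : ℝ) (hκ : 0 < κ)
    (hCκ : (C - κ • (1 : Matrix (Fin N) (Fin N) ℝ)).PosDef)
    (F : Matrix (Fin N) (Fin p) ℝ)
    (Φ : Matrix (Fin p) (Fin p) ℝ → ℝ)
    (hΦconc : ConcaveOn ℝ {A : Matrix (Fin p) (Fin p) ℝ | A.PosSemidef} Φ)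
    (hΦmono : ∀ A B : Matrix (Fin p) (Fin p) ℝ, (B - A).PosSemidef → Φ A ≤ Φ B) :
    ConcaveOn ℝ
      {ξ : Fin N → ℝ | ∑ i, ξ i = 1 ∧ ∀ i, 0 ≤ ξ i ∧ ξ i ≤ 1 / (n : ℝ)}
      (fun ξ =>
        Φ (Fᵀ * (Matrix.diagonal ξ * (C - κ • 1) + (κ / (n : ℝ)) • 1)⁻¹ *
          Matrix.diagonal ξ * F)) := by
  have hc : 0 < κ / (n : ℝ) := div_pos hκ (Nat.cast_pos.mpr hn)
  have hdiag {ξ : Fin N → ℝ} (h : ∀ i, 0 ≤ ξ i ∧ ξ i ≤ 1 / (n : ℝ)) :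
      (diagonal ξ).PosSemidef := PosSemidef.diagonal fun i => (h i).1
  have hL {ξ : Fin N → ℝ} (h : ∀ i, 0 ≤ ξ i ∧ ξ i ≤ 1 / (n : ℝ)) :
      (Fᵀ * (diagonal ξ * (C - κ • 1) + (κ / (n : ℝ)) • 1)⁻¹ * diagonal ξ * F).PosSemidef := by
    have := (hCκ.posSemidef_mul_add_smul_one_inv_mul (hdiag h) hc).conjTranspose_mul_mul_same F
    rwa [conjTranspose_eq_transpose_of_trivial, ← Matrix.mul_assoc] at this
  refine ⟨?_, fun x hx y hy a b ha hb hab => ?_⟩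
  · rintro x ⟨hx, hx'⟩ y ⟨hy, hy'⟩ a b ha hb hab
    refine ⟨?_, fun i => ?_⟩
    · simp [Finset.sum_add_distrib, ← Finset.mul_sum, hx, hy, hab]
    · exact convex_Icc (𝕜 := ℝ) 0 (1 / (n : ℝ)) (hx' i) (hy' i) ha hb hab
  · refine (hΦconc.2 (hL hx.2) (hL hy.2) ha hb hab).trans (hΦmono _ _ ?_)
    have h := (hCκ.posSemidef_mul_add_smul_one_inv_mul_concave (hdiag hx.2) (hdiag hy.2) hc
      ha hb hab).conjTranspose_mul_mul_same F
    have hd : diagonal (a • x + b • y) = a • diagonal x + b • diagonal y := by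
      rw [← diagonal_smul, ← diagonal_smul, diagonal_add]; rfl
    rw [conjTranspose_eq_transpose_of_trivial] at h
    convert h using 1
    rw [← hd]
    simp only [Matrix.mul_sub Fᵀ, Matrix.sub_mul _ _ F, Matrix.mul_add Fᵀ, Matrix.add_mul _ _ F,
      Matrix.mul_smul Fᵀ, Matrix.smul_mul _ _ F, Matrix.mul_assoc]
end

section
/- For all ξ, μ ∈ Ξ and every α ∈ [0,1], the p×p matrix L((1−α)·ξ + α·μ) − ((1−α)·L(ξ) + α·L(μ)) is positive semidefinite; that is, the information matrix map ξ ↦ L(ξ) is concave on Ξ with respect to the Löwner partial order. -/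
open Matrix

/-- A positive definite matrix and its inverse form a positive semidefinite block matrix. -/
theorem Matrix.PosDef.posSemidef_fromBlocks_inv {m : Type*} [Fintype m] [DecidableEq m]
    {M : Matrix m m ℝ} (hM : M.PosDef) : (fromBlocks M 1 1ᴴ M⁻¹).PosSemidef := by
  let _ := hM.isUnit.invertible
  rw [PosDef.fromBlocks₁₁ 1 M⁻¹ hM]
  simpa using PosSemidef.zero

/-- Matrix inversion is convex in the Löwner order. -/
theorem Matrix.PosDef.posSemidef_inv_convexComb {m : Type*} [Fintype m] [DecidableEq m]
    {M₁ M₂ : Matrix m m ℝ} (h₁ : M₁.PosDef) (h₂ : M₂.PosDef) {a b : ℝ} (ha : 0 ≤ a) (hb : 0 ≤ b)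
    (hab : a + b = 1) (h : (a • M₁ + b • M₂).PosDef) :
    (a • M₁⁻¹ + b • M₂⁻¹ - (a • M₁ + b • M₂)⁻¹).PosSemidef := by
  have key := (h₁.posSemidef_fromBlocks_inv.smul ha).add (h₂.posSemidef_fromBlocks_inv.smul hb)
  have hone : a • (1 : Matrix m m ℝ) + b • 1 = 1 := by rw [← add_smul, hab, one_smul]
  simp only [fromBlocks_smul, fromBlocks_add, conjTranspose_one, hone] at key
  rw [← conjTranspose_one (n := m) (α := ℝ)] at key
  let _ := h.isUnit.invertible
  have key' : (fromBlocks (a • M₁ + b • M₂) 1 1ᴴ (a • M₁⁻¹ + b • M₂⁻¹)).PosSemidef := by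
    simpa using key
  rw [PosDef.fromBlocks₁₁ 1 _ h] at key'
  simpa using key'

/-- For `B` invertible, `(D B + k)⁻¹ D` is an affine function of `(D + k B⁻¹)⁻¹`. -/
theorem Matrix.inv_mul_add_smul_one_mul_eq {m : Type*} [Fintype m] [DecidableEq m]
    {D B : Matrix m m ℝ} {k : ℝ} (hB : IsUnit B) (h : IsUnit (D + k • B⁻¹)) :
    (D * B + k • 1)⁻¹ * D = B⁻¹ - k • (B⁻¹ * (D + k • B⁻¹)⁻¹ * B⁻¹) := by
  rw [isUnit_iff_isUnit_det] at hB h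
  have hZ : D * B + k • 1 = (D + k • B⁻¹) * B := by
    rw [add_mul, smul_mul_assoc, nonsing_inv_mul _ hB]
  have hD : (D + k • B⁻¹)⁻¹ * D = 1 - k • ((D + k • B⁻¹)⁻¹ * B⁻¹) := by
    rw [eq_sub_iff_add_eq, ← mul_smul_comm, ← mul_add, nonsing_inv_mul _ h]
  rw [hZ, mul_inv_rev, mul_assoc, hD, mul_sub, mul_one, mul_smul_comm, mul_assoc]

/-- Löwner concavity of the information matrix map `ξ ↦ L ξ` on the set `Ξ`
of design measures: for `ξ, μ ∈ Ξ` and `α ∈ [0,1]` the matrix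
`L ((1-α)•ξ + α•μ) - ((1-α)•L ξ + α•L μ)` is positive semidefinite. -/
theorem stmt_1 (N n p : ℕ) (hN : 0 < N) (hn : 0 < n) (hp : 0 < p)
    (C : Matrix (Fin N) (Fin N) ℝ) (hC : C.PosDef)
    (κ : ℝ) (hκ : 0 < κ)
    (hCκ : (C - κ • (1 : Matrix (Fin N) (Fin N) ℝ)).PosDef)
    (F : Matrix (Fin N) (Fin p) ℝ)
    (L : (Fin N → ℝ) → Matrix (Fin p) (Fin p) ℝ)
    (hL : ∀ ξ, L ξ =
      Fᵀ * (Matrix.diagonal ξ * (C - κ • 1) + (κ / (n : ℝ)) • 1)⁻¹ *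
        Matrix.diagonal ξ * F)
    (ξ μ : Fin N → ℝ)
    (hξ : (∑ i, ξ i = 1) ∧ ∀ i, 0 ≤ ξ i ∧ ξ i ≤ 1 / (n : ℝ))
    (hμ : (∑ i, μ i = 1) ∧ ∀ i, 0 ≤ μ i ∧ μ i ≤ 1 / (n : ℝ))
    (α : ℝ) (hα : α ∈ Set.Icc (0 : ℝ) 1) :
    (L ((1 - α) • ξ + α • μ) - ((1 - α) • L ξ + α • L μ)).PosSemidef := by
  set B : Matrix (Fin N) (Fin N) ℝ := C - κ • 1
  set k : ℝ := κ / n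
  have hk : 0 < k := by positivity
  have hα₀ : 0 ≤ 1 - α := sub_nonneg.2 hα.2
  have hM : ∀ ν : Fin N → ℝ, 0 ≤ ν → (diagonal ν + k • B⁻¹).PosDef := fun ν hν =>
    PosDef.posSemidef_add (.diagonal hν) (hCκ.inv.smul hk)
  have hL' : ∀ ν : Fin N → ℝ, 0 ≤ ν →
      L ν = Fᵀ * (B⁻¹ - k • (B⁻¹ * (diagonal ν + k • B⁻¹)⁻¹ * B⁻¹)) * F := fun ν hν => by
    rw [hL, Matrix.mul_assoc Fᵀ, inv_mul_add_smul_one_mul_eq hCκ.isUnit (hM ν hν).isUnit]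
  have hξ₀ : 0 ≤ ξ := fun i => (hξ.2 i).1
  have hμ₀ : 0 ≤ μ := fun i => (hμ.2 i).1
  have hmix₀ : 0 ≤ (1 - α) • ξ + α • μ :=
    add_nonneg (smul_nonneg hα₀ hξ₀) (smul_nonneg hα.1 hμ₀)
  have hmix : diagonal ((1 - α) • ξ + α • μ) + k • B⁻¹ =
      (1 - α) • (diagonal ξ + k • B⁻¹) + α • (diagonal μ + k • B⁻¹) := by
    rw [show diagonal ((1 - α) • ξ + α • μ) = (1 - α) • diagonal ξ + α • diagonal μ by
      rw [← diagonal_smul, ← diagonal_smul, diagonal_add]; rfl]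
    module
  have hpos := hM _ hmix₀
  rw [hL' _ hmix₀, hL' _ hξ₀, hL' _ hμ₀, hmix]
  rw [hmix] at hpos
  have hconv := (hM ξ hξ₀).posSemidef_inv_convexComb (hM μ hμ₀) hα₀ hα.1 (by ring) hpos
  have hBt : (B⁻¹)ᵀ = B⁻¹ := by simpa using hCκ.inv.isHermitian.eq
  convert (hconv.conjTranspose_mul_mul_same (B⁻¹ * F)).smul hk.le using 1
  simp only [conjTranspose_eq_transpose_of_trivial, transpose_mul, hBt, Matrix.mul_sub,
    Matrix.sub_mul, Matrix.mul_add,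
    Matrix.add_mul, Matrix.mul_smul, Matrix.smul_mul, Matrix.mul_assoc]
  module
end

section
/- Let u ∈ ℝ^N and let (ξ_k) be a sequence of designs in Ξ with strictly positive entries converging (entrywise) to some ξ ∈ Ξ. Then uᵀ * (C + W(ξ_k))⁻¹ * u converges to uᵀ * Z(ξ)⁻¹ * diagonal(ξ) * u as k → ∞. -/
open Matrix

/-- If `A` is positive definite, `d` is nonnegative and `0 < c`, then `diagonal d * A + c • 1`
is nonsingular. -/
lemma det_diagonal_mul_posDef_add_smul_one_ne_zero {ι : Type*} [Fintype ι] [DecidableEq ι]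
    {A : Matrix ι ι ℝ} (hA : A.PosDef) {d : ι → ℝ} (hd : ∀ i, 0 ≤ d i) {c : ℝ} (hc : 0 < c) :
    (diagonal d * A + c • (1 : Matrix ι ι ℝ)).det ≠ 0 := by
  intro hdet
  obtain ⟨v, hv, hzero⟩ := exists_mulVec_eq_zero_iff.mpr hdet
  have hcoord : ∀ i, d i * (A *ᵥ v) i + c * v i = 0 := fun i => by
    have := congrFun hzero i
    rwa [add_mulVec, smul_mulVec, one_mulVec, ← mulVec_mulVec, Pi.add_apply, mulVec_diagonal,
      Pi.smul_apply, smul_eq_mul, Pi.zero_apply] at this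
  have hpos : 0 < v ⬝ᵥ (A *ᵥ v) := by simpa using hA.dotProduct_mulVec_pos hv
  have hneg : c * (v ⬝ᵥ (A *ᵥ v)) ≤ 0 := by
    rw [dotProduct, Finset.mul_sum]
    refine Finset.sum_nonpos fun i _ => ?_
    linear_combination (A *ᵥ v) i * hcoord i + mul_nonneg (hd i) (sq_nonneg ((A *ᵥ v) i))
  exact hneg.not_gt (mul_pos hc hpos)

/-- For positive `d`, the inverse of `C + diagonal (κ (a - d i) / d i)` is
`(diagonal d * (C - κ • 1) + (κ a) • 1)⁻¹ * diagonal d`. -/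
lemma inv_add_diagonal_eq {ι : Type*} [Fintype ι] [DecidableEq ι] (C : Matrix ι ι ℝ) (κ a : ℝ)
    {d : ι → ℝ} (hd : ∀ i, 0 < d i) :
    (C + diagonal fun i => κ * (a - d i) / d i)⁻¹ =
      (diagonal d * (C - κ • 1) + (κ * a) • (1 : Matrix ι ι ℝ))⁻¹ * diagonal d := by
  have hfactor : diagonal d * (C - κ • 1) + (κ * a) • (1 : Matrix ι ι ℝ) =
      diagonal d * (C + diagonal fun i => κ * (a - d i) / d i) := by
    ext i j
    have hi := (hd i).ne'
    by_cases hij : i = j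
    · subst hij
      simp [diagonal_mul]
      field_simp
      ring
    · simp [diagonal_mul, hij]
  have hdet : IsUnit (diagonal d).det := by
    rw [det_diagonal]
    exact (Finset.prod_pos fun i _ => hd i).ne'.isUnit
  rw [hfactor, Matrix.mul_inv_rev, Matrix.mul_assoc, nonsing_inv_mul _ hdet, Matrix.mul_one]

/-- **Lemma A2** (continuity): if designs `ξ k ∈ Ξ` with strictly positive entries
converge entrywise to `ξ ∈ Ξ`, then `uᵀ (C + W(ξ k))⁻¹ u` converges to
`uᵀ Z(ξ)⁻¹ diagonal(ξ) u`, where `W(η) = diagonal (κ (1/n - η i) / η i)` and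
`Z ξ = diagonal ξ * (C - κ•I) + (κ/n)•I`. -/
theorem stmt_3 (N n p : ℕ) (hN : 0 < N) (hn : 0 < n) (hp : 0 < p)
    (C : Matrix (Fin N) (Fin N) ℝ) (hC : C.PosDef)
    (κ : ℝ) (hκ : 0 < κ)
    (hCκ : (C - κ • (1 : Matrix (Fin N) (Fin N) ℝ)).PosDef)
    (u : Fin N → ℝ)
    (ξseq : ℕ → Fin N → ℝ)
    (hseqΞ : ∀ k, (∑ i, ξseq k i = 1) ∧ ∀ i, 0 ≤ ξseq k i ∧ ξseq k i ≤ 1 / (n : ℝ))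
    (hseqpos : ∀ k i, 0 < ξseq k i)
    (ξ : Fin N → ℝ)
    (hξ : (∑ i, ξ i = 1) ∧ ∀ i, 0 ≤ ξ i ∧ ξ i ≤ 1 / (n : ℝ))
    (hconv : ∀ i, Filter.Tendsto (fun k => ξseq k i) Filter.atTop (nhds (ξ i))) :
    Filter.Tendsto
      (fun k =>
        u ⬝ᵥ ((C + Matrix.diagonal (fun i => κ * (1 / (n : ℝ) - ξseq k i) / ξseq k i))⁻¹ *ᵥ u))
      Filter.atTop
      (nhds (u ⬝ᵥ (((Matrix.diagonal ξ * (C - κ • 1) + (κ / (n : ℝ)) • 1)⁻¹ *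
        Matrix.diagonal ξ) *ᵥ u))) := by
  have hn' : (0 : ℝ) < n := Nat.cast_pos.mpr hn
  have hdet := det_diagonal_mul_posDef_add_smul_one_ne_zero hCκ (fun i => (hξ.2 i).1)
    (div_pos hκ hn')
  have hdiag : Filter.Tendsto (fun k => diagonal (ξseq k)) Filter.atTop (nhds (diagonal ξ)) :=
    (continuous_id.matrix_diagonal.tendsto ξ).comp (tendsto_pi_nhds.mpr hconv)
  have hZ := (hdiag.mul_const (C - κ • (1 : Matrix (Fin N) (Fin N) ℝ))).add_const
    ((κ / (n : ℝ)) • (1 : Matrix (Fin N) (Fin N) ℝ))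
  have hinv : ContinuousAt Ring.inverse
      (diagonal ξ * (C - κ • 1) + (κ / (n : ℝ)) • (1 : Matrix (Fin N) (Fin N) ℝ)).det := by
    rw [Ring.inverse_eq_inv']
    exact continuousAt_inv₀ hdet
  have hlim := ((continuousAt_matrix_inv _ hinv).tendsto.comp hZ).mul hdiag
  have hquad : Continuous fun M : Matrix (Fin N) (Fin N) ℝ => u ⬝ᵥ (M *ᵥ u) := by fun_prop
  refine ((hquad.tendsto _).comp hlim).congr fun k => ?_
  simp only [Function.comp_apply]
  rw [inv_add_diagonal_eq C κ (1 / (n : ℝ)) (hseqpos k), mul_one_div]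
end

section
/- For every ξ ∈ Ξ (indeed, for every ξ : Fin N → ℝ with all entries nonnegative), the N×N matrix Z(ξ) = diagonal(ξ) * (C − κ·I) + (κ/n)·I is invertible. -/
open Matrix

/-- If `D` is positive semidefinite, `A` is positive definite and `c > 0`, then `D * A + c • 1` is
invertible. -/
theorem Matrix.PosDef.isUnit_mul_add_smul_one {m : Type*} [Fintype m] [DecidableEq m]
    {D A : Matrix m m ℝ} (hA : A.PosDef) (hD : D.PosSemidef) {c : ℝ} (hc : 0 < c) :
    IsUnit (D * A + c • 1) := by
  rw [← mulVec_injective_iff_isUnit, ← coe_mulVecLin, injective_iff_map_eq_zero]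
  intro v hv
  rw [mulVecLin_apply] at hv
  by_contra hv0
  have hpos := hA.dotProduct_mulVec_pos hv0
  have hnonneg := hD.dotProduct_mulVec_nonneg (A *ᵥ v)
  have key : (A *ᵥ v) ⬝ᵥ ((D * A + c • 1) *ᵥ v) = 0 := by
    rw [hv, dotProduct_zero]
  rw [add_mulVec, ← mulVec_mulVec, smul_mulVec, one_mulVec, dotProduct_add, dotProduct_smul,
    smul_eq_mul, dotProduct_comm _ v] at key
  simp only [star_trivial] at hpos hnonneg
  linarith [mul_pos hc hpos]

/-- **Lemma A4, first assertion**: for every `ξ : Fin N → ℝ` with nonnegative entries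
(in particular for every `ξ ∈ Ξ`), the matrix
`Z ξ = diagonal ξ * (C - κ•I) + (κ/n)•I` is invertible. -/
theorem stmt_4 (N n p : ℕ) (hN : 0 < N) (hn : 0 < n) (hp : 0 < p)
    (C : Matrix (Fin N) (Fin N) ℝ) (hC : C.PosDef)
    (κ : ℝ) (hκ : 0 < κ)
    (hCκ : (C - κ • (1 : Matrix (Fin N) (Fin N) ℝ)).PosDef)
    (ξ : Fin N → ℝ) (hξ : ∀ i, 0 ≤ ξ i) :
    IsUnit (Matrix.diagonal ξ * (C - κ • 1) + (κ / (n : ℝ)) • 1) := by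
  exact hCκ.isUnit_mul_add_smul_one (.diagonal hξ) (by positivity)
end

section
/- The map ξ ↦ L(ξ) = Fᵀ * Z(ξ)⁻¹ * diagonal(ξ) * F is continuous on the set Ξ (with respect to the standard topology on Fin N → ℝ and on p×p real matrices). -/
open Matrix

/-- The product of a positive semidefinite and a positive definite matrix has no negative
eigenvalue. -/
theorem Matrix.PosSemidef.det_mul_add_smul_one_ne_zero {m : Type*} [Fintype m] [DecidableEq m]
    {A B : Matrix m m ℝ} (hA : A.PosSemidef) (hB : B.PosDef) {c : ℝ} (hc : 0 < c) :
    (A * B + c • (1 : Matrix m m ℝ)).det ≠ 0 := by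
  rw [Ne, ← Matrix.exists_mulVec_eq_zero_iff]
  rintro ⟨v, hv, h⟩
  have hAB : A *ᵥ (B *ᵥ v) = -(c • v) := by
    rw [← add_eq_zero_iff_eq_neg]
    simpa [add_mulVec, smul_mulVec, mulVec_mulVec] using h
  have h_nonneg := hA.dotProduct_mulVec_nonneg (B *ᵥ v)
  have h_pos := hB.dotProduct_mulVec_pos hv
  rw [hAB, star_trivial, dotProduct_neg, dotProduct_smul, smul_eq_mul, dotProduct_comm] at h_nonneg
  rw [star_trivial] at h_pos
  nlinarith [mul_pos hc h_pos]

/-- **Lemma A4** (continuity): the information matrix map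
`ξ ↦ L ξ = Fᵀ Z(ξ)⁻¹ diagonal(ξ) F` is continuous on the set `Ξ` of design
measures, where `Z ξ = diagonal ξ * (C - κ•I) + (κ/n)•I`. -/
theorem stmt_5 (N n p : ℕ) (hN : 0 < N) (hn : 0 < n) (hp : 0 < p)
    (C : Matrix (Fin N) (Fin N) ℝ) (hC : C.PosDef)
    (κ : ℝ) (hκ : 0 < κ)
    (hCκ : (C - κ • (1 : Matrix (Fin N) (Fin N) ℝ)).PosDef)
    (F : Matrix (Fin N) (Fin p) ℝ) :
    ContinuousOn
      (fun ξ : Fin N → ℝ =>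
        Fᵀ * (Matrix.diagonal ξ * (C - κ • 1) + (κ / (n : ℝ)) • 1)⁻¹ *
          Matrix.diagonal ξ * F)
      {ξ : Fin N → ℝ | ∑ i, ξ i = 1 ∧ ∀ i, 0 ≤ ξ i ∧ ξ i ≤ 1 / (n : ℝ)} := by
  intro ξ hξ
  have hdet := (PosSemidef.diagonal fun i => (hξ.2 i).1).det_mul_add_smul_one_ne_zero hCκ
    (div_pos hκ (Nat.cast_pos.mpr hn : (0 : ℝ) < n))
  have hZ : ContinuousAt (fun ξ : Fin N → ℝ =>
      (diagonal ξ * (C - κ • 1) + (κ / (n : ℝ)) • 1)⁻¹) ξ := by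
    refine ContinuousAt.comp (g := Inv.inv) (continuousAt_matrix_inv _ ?_) (by fun_prop)
    rw [Ring.inverse_eq_inv']
    exact continuousAt_inv₀ hdet
  have hL : Continuous fun q : Matrix (Fin N) (Fin N) ℝ × (Fin N → ℝ) =>
      Fᵀ * q.1 * diagonal q.2 * F := by fun_prop
  exact (hL.continuousAt.comp (hZ.prodMk continuousAt_id)).continuousWithinAt
end

section
/- For every design ξ ∈ Ξ with strictly positive entries, the matrix C + W(ξ) is invertible and L(ξ) = Fᵀ * Z(ξ)⁻¹ * diagonal(ξ) * F = Fᵀ * (C + W(ξ))⁻¹ * F; that is, on full-support designs the globally defined matrix L(ξ) coincides with the information matrix M(ξ) of the virtual-noise model. -/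
open Matrix

/-- **Lemma A4** (identity `L(ξ) = M(ξ)` on full-support designs): for `ξ ∈ Ξ` with
strictly positive entries, `C + W(ξ)` is invertible and
`Fᵀ Z(ξ)⁻¹ diagonal(ξ) F = Fᵀ (C + W(ξ))⁻¹ F`, where
`W(ξ) = diagonal (κ (1/n - ξ i) / ξ i)` and `Z ξ = diagonal ξ * (C - κ•I) + (κ/n)•I`. -/
theorem stmt_6 (N n p : ℕ) (hN : 0 < N) (hn : 0 < n) (hp : 0 < p)
    (C : Matrix (Fin N) (Fin N) ℝ) (hC : C.PosDef)
    (κ : ℝ) (hκ : 0 < κ)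
    (hCκ : (C - κ • (1 : Matrix (Fin N) (Fin N) ℝ)).PosDef)
    (F : Matrix (Fin N) (Fin p) ℝ)
    (ξ : Fin N → ℝ)
    (hξ : (∑ i, ξ i = 1) ∧ ∀ i, 0 ≤ ξ i ∧ ξ i ≤ 1 / (n : ℝ))
    (hpos : ∀ i, 0 < ξ i) :
    IsUnit (C + Matrix.diagonal (fun i => κ * (1 / (n : ℝ) - ξ i) / ξ i)) ∧
    Fᵀ * (Matrix.diagonal ξ * (C - κ • 1) + (κ / (n : ℝ)) • 1)⁻¹ *
      Matrix.diagonal ξ * F =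
    Fᵀ * (C + Matrix.diagonal (fun i => κ * (1 / (n : ℝ) - ξ i) / ξ i))⁻¹ * F := by
  have hunit : IsUnit
      (C + Matrix.diagonal (fun i => κ * (1 / (n : ℝ) - ξ i) / ξ i)) := by
    refine (hC.add_posSemidef (PosSemidef.diagonal fun i => ?_)).isUnit
    exact div_nonneg (mul_nonneg hκ.le (sub_nonneg.2 (hξ.2 i).2)) (hpos i).le
  have hdiag : IsUnit (Matrix.diagonal ξ).det := by
    rw [det_diagonal]
    exact (Finset.prod_pos fun i _ => hpos i).ne'.isUnit
  have hfactor : Matrix.diagonal ξ * (C - κ • 1) + (κ / (n : ℝ)) • 1 =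
      Matrix.diagonal ξ *
        (C + Matrix.diagonal (fun i => κ * (1 / (n : ℝ) - ξ i) / ξ i)) := by
    ext i j
    have hi := (hpos i).ne'
    by_cases hij : i = j
    · subst hij
      simp [diagonal_mul]
      field_simp
      ring
    · simp [diagonal_mul, hij]
  refine ⟨hunit, ?_⟩
  rw [hfactor, Matrix.mul_inv_rev, ← Matrix.mul_assoc, Matrix.mul_assoc _ (Matrix.diagonal ξ)⁻¹,
    nonsing_inv_mul _ hdiag, Matrix.mul_one]
end

section
/- Let ξ̄, μ ∈ Ξ. Then the map α ↦ L((1−α)·ξ̄ + α·μ) has right derivative at α = 0 (derivative within [0,∞) at 0) equal to the p×p matrix (κ/n) · Fᵀ * Z(ξ̄)⁻¹ * diagonal(μ − ξ̄) * (Z(ξ̄)ᵀ)⁻¹ * F. -/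
open Matrix

attribute [local instance] Matrix.normedAddCommGroup Matrix.normedSpace

open scoped Topology

section DiagonalPencil

variable {m : Type*} [Fintype m] [DecidableEq m]

/-- If `A` is positive definite, `d` is nonnegative and `c > 0`, then `diagonal d * A + c • 1` is
nonsingular. -/
theorem Matrix.PosDef.det_diagonal_mul_add_smul_one_ne_zero {A : Matrix m m ℝ} (hA : A.PosDef)
    {d : m → ℝ} (hd : ∀ i, 0 ≤ d i) {c : ℝ} (hc : 0 < c) :
    (diagonal d * A + c • (1 : Matrix m m ℝ)).det ≠ 0 := by
  have hAt : Aᵀ = A := by simpa using hA.isHermitian.eq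
  rw [← det_transpose]
  intro hdet
  obtain ⟨v, hv, h⟩ := exists_mulVec_eq_zero_iff.mpr hdet
  have hker : A *ᵥ (diagonal d *ᵥ v) = -(c • v) := by
    rw [eq_neg_iff_add_eq_zero, ← h]
    simp [hAt, add_mulVec, smul_mulVec, mulVec_mulVec]
  by_cases hdv : diagonal d *ᵥ v = 0
  · rw [hdv, mulVec_zero, eq_comm, neg_eq_zero, smul_eq_zero] at hker
    exact hker.elim hc.ne' hv
  · have hpos := hA.dotProduct_mulVec_pos hdv
    have hnonneg : 0 ≤ (diagonal d *ᵥ v) ⬝ᵥ v := by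
      refine Finset.sum_nonneg fun i _ => ?_
      rw [mulVec_diagonal, mul_assoc]
      exact mul_nonneg (hd i) (mul_self_nonneg _)
    rw [hker, star_trivial, dotProduct_neg, dotProduct_smul, smul_eq_mul] at hpos
    linarith [mul_nonneg hc.le hnonneg]

/-- A resolvent-type identity for the map `d ↦ (diagonal d * A + c • 1)⁻¹ * diagonal d`. -/
theorem Matrix.inv_mul_diagonal_sub_inv_mul_diagonal {A : Matrix m m ℝ} (hA : A.IsSymm)
    {c : ℝ} {d e : m → ℝ}
    (hd : (diagonal d * A + c • (1 : Matrix m m ℝ)).det ≠ 0)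
    (he : (diagonal e * A + c • (1 : Matrix m m ℝ)).det ≠ 0) :
    (diagonal e * A + c • (1 : Matrix m m ℝ))⁻¹ * diagonal e -
        (diagonal d * A + c • (1 : Matrix m m ℝ))⁻¹ * diagonal d =
      c • ((diagonal e * A + c • (1 : Matrix m m ℝ))⁻¹ * diagonal (e - d) *
        (diagonal d * A + c • (1 : Matrix m m ℝ))ᵀ⁻¹) := by
  set P := diagonal d * A + c • (1 : Matrix m m ℝ) with hP
  set Q := diagonal e * A + c • (1 : Matrix m m ℝ) with hQ
  have hPu : IsUnit P.det := hd.isUnit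
  have hPtu : IsUnit Pᵀ.det := by rwa [det_transpose]
  have hQu : IsUnit Q.det := he.isUnit
  have hPt : Pᵀ = A * diagonal d + c • 1 := by simp [hP, hA.eq]
  have hcomm : P⁻¹ * diagonal d = diagonal d * Pᵀ⁻¹ := by
    have h : diagonal d * Pᵀ = P * diagonal d := by
      rw [hPt, hP]
      simp [mul_add, add_mul, mul_assoc]
    calc P⁻¹ * diagonal d = P⁻¹ * (diagonal d * Pᵀ) * Pᵀ⁻¹ := by
          rw [← mul_assoc, mul_nonsing_inv_cancel_right _ _ hPtu]
      _ = diagonal d * Pᵀ⁻¹ := by rw [h, nonsing_inv_mul_cancel_left _ _ hPu]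
  have hmid : diagonal e * Pᵀ - Q * diagonal d = c • diagonal (e - d) := by
    have hdiag : diagonal (e - d) = diagonal e - diagonal d := (diagonal_sub e d).symm
    rw [hPt, hQ, hdiag, mul_add, add_mul, mul_assoc, add_sub_add_left_eq_sub, smul_sub,
      Matrix.mul_smul, Matrix.smul_mul, mul_one, one_mul]
  calc Q⁻¹ * diagonal e - P⁻¹ * diagonal d
      = Q⁻¹ * (diagonal e * Pᵀ - Q * diagonal d) * Pᵀ⁻¹ := by
        rw [hcomm, mul_sub, sub_mul, nonsing_inv_mul_cancel_left _ _ hQu, ← mul_assoc,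
          mul_nonsing_inv_cancel_right _ _ hPtu]
    _ = c • (Q⁻¹ * diagonal (e - d) * Pᵀ⁻¹) := by
        rw [hmid, Matrix.mul_smul, Matrix.smul_mul]

end DiagonalPencil

/-- If `f t = f 0 + t • g t` near `0` and `g` is continuous at `0`, then `f` has derivative `g 0`
at `0`. -/
theorem hasDerivAt_zero_of_eventually_eq_add_smul {E : Type*} [NormedAddCommGroup E]
    [NormedSpace ℝ E] {f g : ℝ → E} (hg : ContinuousAt g 0)
    (h : ∀ᶠ t in 𝓝 0, f t - f 0 = t • g t) : HasDerivAt f (g 0) 0 := by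
  rw [hasDerivAt_iff_tendsto_slope_zero]
  refine (hg.tendsto.mono_left nhdsWithin_le_nhds).congr' ?_
  filter_upwards [h.filter_mono nhdsWithin_le_nhds, self_mem_nhdsWithin] with t ht ht0
  rw [zero_add, ht, inv_smul_smul₀ ht0]

/-- **Lemma A4** (right derivative of the information matrix): for `ξ̄, μ ∈ Ξ`, the
map `α ↦ L ((1-α)•ξ̄ + α•μ)` has right derivative at `α = 0` equal to
`(κ/n) • Fᵀ Z(ξ̄)⁻¹ diagonal (μ - ξ̄) (Z(ξ̄)ᵀ)⁻¹ F`, where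
`Z ξ = diagonal ξ * (C - κ•I) + (κ/n)•I` and `L ξ = Fᵀ Z(ξ)⁻¹ diagonal(ξ) F`. -/
theorem stmt_8 (N n p : ℕ) (hN : 0 < N) (hn : 0 < n) (hp : 0 < p)
    (C : Matrix (Fin N) (Fin N) ℝ) (hC : C.PosDef)
    (κ : ℝ) (hκ : 0 < κ)
    (hCκ : (C - κ • (1 : Matrix (Fin N) (Fin N) ℝ)).PosDef)
    (F : Matrix (Fin N) (Fin p) ℝ)
    (Z : (Fin N → ℝ) → Matrix (Fin N) (Fin N) ℝ)
    (hZ : ∀ ξ, Z ξ = Matrix.diagonal ξ * (C - κ • 1) + (κ / (n : ℝ)) • 1)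
    (L : (Fin N → ℝ) → Matrix (Fin p) (Fin p) ℝ)
    (hL : ∀ ξ, L ξ = Fᵀ * (Z ξ)⁻¹ * Matrix.diagonal ξ * F)
    (ξbar μ : Fin N → ℝ)
    (hξbar : (∑ i, ξbar i = 1) ∧ ∀ i, 0 ≤ ξbar i ∧ ξbar i ≤ 1 / (n : ℝ))
    (hμ : (∑ i, μ i = 1) ∧ ∀ i, 0 ≤ μ i ∧ μ i ≤ 1 / (n : ℝ)) :
    HasDerivWithinAt (fun α : ℝ => L ((1 - α) • ξbar + α • μ))
      ((κ / (n : ℝ)) •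
        (Fᵀ * (Z ξbar)⁻¹ * Matrix.diagonal (μ - ξbar) * ((Z ξbar)ᵀ)⁻¹ * F))
      (Set.Ici (0 : ℝ)) 0 := by
  set A := C - κ • (1 : Matrix (Fin N) (Fin N) ℝ)
  have hc : 0 < κ / (n : ℝ) := by positivity
  set c := κ / (n : ℝ)
  have hA : A.IsSymm := by simpa [IsSymm] using hCκ.isHermitian.eq
  have hdet : (Z ξbar).det ≠ 0 := by
    rw [hZ]
    exact hCκ.det_diagonal_mul_add_smul_one_ne_zero (fun i => (hξbar.2 i).1) hc
  have hpath0 : (1 - (0 : ℝ)) • ξbar + (0 : ℝ) • μ = ξbar := by simp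
  have hpath (α : ℝ) : (1 - α) • ξbar + α • μ - ξbar = α • (μ - ξbar) := by module
  have hZcont : Continuous fun α : ℝ => Z ((1 - α) • ξbar + α • μ) := by
    simp only [hZ]
    fun_prop
  have hinv : ContinuousAt (fun α : ℝ => (Z ((1 - α) • ξbar + α • μ))⁻¹) 0 := by
    refine ContinuousAt.comp (g := Inv.inv) ?_ hZcont.continuousAt
    refine continuousAt_matrix_inv _ ?_
    rw [hpath0, Ring.inverse_eq_inv']
    exact continuousAt_inv₀ hdet
  have hev : ∀ᶠ α : ℝ in 𝓝 0, (Z ((1 - α) • ξbar + α • μ)).det ≠ 0 :=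
    hZcont.matrix_det.continuousAt.eventually_ne (by rwa [hpath0])
  have hmul : Continuous fun M : Matrix (Fin N) (Fin N) ℝ =>
      c • (Fᵀ * M * diagonal (μ - ξbar) * ((Z ξbar)ᵀ)⁻¹ * F) := by
    fun_prop
  have hderiv := hasDerivAt_zero_of_eventually_eq_add_smul
    (f := fun α : ℝ => L ((1 - α) • ξbar + α • μ))
    (hmul.continuousAt.comp hinv) (by
      filter_upwards [hev] with α hα
      simp only [hpath0, hL, Function.comp_apply]
      rw [hZ] at hα hdet
      have h := inv_mul_diagonal_sub_inv_mul_diagonal hA hdet hα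
      rw [← hZ, ← hZ, hpath, diagonal_smul] at h
      have h' := congrArg (fun M => Fᵀ * M * F) h
      simpa [Matrix.mul_sub, Matrix.sub_mul, Matrix.mul_assoc, smul_comm c α] using h')
  simp only [Function.comp_apply, hpath0] at hderiv
  exact hderiv.hasDerivWithinAt
end

section
/- Let ξ : Fin N → ℝ have all entries nonnegative. Then the matrix diagonal(ξ) + (κ/n)·(C − κ·I)⁻¹ is invertible, the identity (C − κ·I) * Z(ξ)⁻¹ = (diagonal(ξ) + (κ/n)·(C − κ·I)⁻¹)⁻¹ holds, and this matrix is symmetric positive definite. -/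
open Matrix

/-- Key step in the proof of **Lemma A1**: for `ξ` with nonnegative entries, the
matrix `diagonal ξ + (κ/n) • (C - κ•I)⁻¹` is invertible, one has
`(C - κ•I) * Z(ξ)⁻¹ = (diagonal ξ + (κ/n) • (C - κ•I)⁻¹)⁻¹`, and this matrix is
symmetric positive definite, where `Z ξ = diagonal ξ * (C - κ•I) + (κ/n)•I`. -/
theorem stmt_9 (N n : ℕ) (hN : 0 < N) (hn : 0 < n)
    (C : Matrix (Fin N) (Fin N) ℝ) (hC : C.PosDef)
    (κ : ℝ) (hκ : 0 < κ)
    (hCκ : (C - κ • (1 : Matrix (Fin N) (Fin N) ℝ)).PosDef)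
    (ξ : Fin N → ℝ) (hξ : ∀ i, 0 ≤ ξ i) :
    IsUnit (Matrix.diagonal ξ + (κ / (n : ℝ)) • (C - κ • 1)⁻¹) ∧
    (C - κ • 1) * (Matrix.diagonal ξ * (C - κ • 1) + (κ / (n : ℝ)) • 1)⁻¹ =
      (Matrix.diagonal ξ + (κ / (n : ℝ)) • (C - κ • 1)⁻¹)⁻¹ ∧
    ((C - κ • 1) * (Matrix.diagonal ξ * (C - κ • 1) + (κ / (n : ℝ)) • 1)⁻¹).PosDef := by
  have hc : 0 < κ / (n : ℝ) := by positivity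
  generalize κ / (n : ℝ) = c at hc ⊢
  generalize C - κ • (1 : Matrix (Fin N) (Fin N) ℝ) = M at hCκ ⊢
  have hA : (Matrix.diagonal ξ + c • M⁻¹).PosDef :=
    Matrix.PosDef.posSemidef_add (Matrix.PosSemidef.diagonal hξ) (hCκ.inv.smul hc)
  have hM : IsUnit M.det := (Matrix.isUnit_iff_isUnit_det M).mp hCκ.isUnit
  have hZ : Matrix.diagonal ξ * M + c • 1 = (Matrix.diagonal ξ + c • M⁻¹) * M := by
    rw [add_mul, smul_mul_assoc, Matrix.nonsing_inv_mul M hM]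
  have hinv : M * (Matrix.diagonal ξ * M + c • 1)⁻¹ = (Matrix.diagonal ξ + c • M⁻¹)⁻¹ := by
    rw [hZ, Matrix.mul_inv_rev, Matrix.mul_nonsing_inv_cancel_left _ _ hM]
  exact ⟨hA.isUnit, hinv, hinv ▸ hA.inv⟩
end

section
/- Let ξ̄ ∈ Ξ, let Φ be a real-valued function on p×p real matrices that is concave on positive semidefinite matrices and Löwner-increasing, and suppose Φ is Fréchet-differentiable at L(ξ̄) with derivative A ↦ trace(D * A) for a symmetric p×p matrix D. Let h(i) = ((Z(ξ̄)ᵀ)⁻¹ * F * D * Fᵀ * Z(ξ̄)⁻¹) i i for i : Fin N. Then ξ̄ maximizes Φ ∘ L over Ξ if and only if for every subset S of Fin N of cardinality n, (1/n) · ∑_{i ∈ S} h(i) ≤ ∑_{i} ξ̄(i) · h(i). -/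
open Matrix

attribute [local instance] Matrix.normedAddCommGroup Matrix.normedSpace

/-- A function on `ℝ` with a one-sided minimum over `[0, 1]` at `0` has nonnegative right
derivative. -/
theorem HasDerivWithinAt.nonneg_of_forall_Icc_le {g : ℝ → ℝ} {g' : ℝ}
    (hg : HasDerivWithinAt g g' (Set.Ioi 0) 0)
    (hmin : ∀ t ∈ Set.Icc (0 : ℝ) 1, g 0 ≤ g t) : 0 ≤ g' := by
  refine ge_of_tendsto ((hasDerivWithinAt_iff_tendsto_slope' Set.self_notMem_Ioi).1 hg) ?_
  filter_upwards [Ioo_mem_nhdsGT (zero_lt_one' ℝ)] with t ht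
  rw [slope_def_field]
  exact div_nonneg (sub_nonneg.2 (hmin t ⟨ht.1.le, ht.2.le⟩)) (sub_nonneg.2 ht.1.le)

theorem hasDerivWithinAt_Ioi_zero_of_sub_eq_smul {E : Type*} [NormedAddCommGroup E]
    [NormedSpace ℝ E] {f g : ℝ → E} (hg : ContinuousAt g 0)
    (hfg : ∀ t ∈ Set.Ioo (0 : ℝ) 1, f t - f 0 = t • g t) :
    HasDerivWithinAt f (g 0) (Set.Ioi 0) 0 := by
  rw [hasDerivWithinAt_iff_tendsto_slope' Set.self_notMem_Ioi]
  refine (hg.tendsto.mono_left nhdsWithin_le_nhds).congr' ?_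
  filter_upwards [Ioo_mem_nhdsGT (zero_lt_one' ℝ)] with t ht
  rw [slope_def_module, hfg t ht, sub_zero, smul_smul, inv_mul_cancel₀ ht.1.ne', one_smul]

theorem HasFDerivAt.hasDerivAt_line {E : Type*} [NormedAddCommGroup E] [NormedSpace ℝ E]
    {f : E → ℝ} {f' : E →L[ℝ] ℝ} {x : E} (hf : HasFDerivAt f f' x) (v : E) :
    HasDerivAt (fun t : ℝ => f (x + t • v)) (f' v) 0 :=
  hf.hasLineDerivAt v

/-- The supergradient inequality for a concave function that is differentiable at a point. -/
theorem ConcaveOn.le_add_hasFDerivAt {E : Type*} [NormedAddCommGroup E] [NormedSpace ℝ E]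
    {s : Set E} {f : E → ℝ} {f' : E →L[ℝ] ℝ} {x y : E} (hc : ConcaveOn ℝ s f)
    (hx : x ∈ s) (hy : y ∈ s) (hf : HasFDerivAt f f' x) : f y ≤ f x + f' (y - x) := by
  have hg : HasDerivAt (fun t : ℝ => f (x + t • (y - x)) - t * (f y - f x))
      (f' (y - x) - 1 * (f y - f x)) 0 :=
    (hf.hasDerivAt_line (y - x)).sub ((hasDerivAt_id (0 : ℝ)).mul_const _)
  have := hg.hasDerivWithinAt.nonneg_of_forall_Icc_le fun t ht => by
    have h1 := hc.2 hx hy (sub_nonneg.2 ht.2) ht.1 (by ring)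
    have h2 : (1 - t) • x + t • y = x + t • (y - x) := by module
    rw [h2, smul_eq_mul, smul_eq_mul] at h1
    simp only [zero_smul, add_zero, zero_mul, sub_zero]
    linarith
  linarith

/-- The average of `h` against weights in `[0, 1/n]` summing to one is at most the mean of `h`
over some subset of cardinality `n`. -/
theorem exists_card_eq_sum_mul_le {ι : Type*} [Fintype ι] [DecidableEq ι] {n : ℕ} (hn : 0 < n)
    (hcard : n ≤ Fintype.card ι) {ξ : ι → ℝ} (hsum : ∑ i, ξ i = 1)
    (hξ : ∀ i, 0 ≤ ξ i ∧ ξ i ≤ 1 / (n : ℝ)) (h : ι → ℝ) :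
    ∃ S : Finset ι, S.card = n ∧ ∑ i, ξ i * h i ≤ 1 / (n : ℝ) * ∑ i ∈ S, h i := by
  have hne : (Finset.univ.powersetCard n : Finset (Finset ι)).Nonempty :=
    Finset.powersetCard_nonempty.2 hcard
  obtain ⟨S, hS, hmax⟩ := Finset.exists_max_image _ (fun S => ∑ i ∈ S, h i) hne
  rw [Finset.mem_powersetCard_univ] at hS
  obtain ⟨k, hkS, hk⟩ := Finset.exists_min_image S h (Finset.card_pos.1 (by omega))
  refine ⟨S, hS, ?_⟩
  have hout : ∀ j ∉ S, h j ≤ h k := fun j hj => by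
    have hj' : j ∉ S.erase k := fun hmem => hj (Finset.mem_of_mem_erase hmem)
    have := hmax (insert j (S.erase k)) <| by
      rw [Finset.mem_powersetCard_univ, Finset.card_insert_of_notMem hj',
        Finset.card_erase_of_mem hkS]
      omega
    rw [Finset.sum_insert hj', ← Finset.add_sum_erase S h hkS] at this
    linarith
  have hn0 : (n : ℝ) ≠ 0 := by positivity
  have hS1 : ∑ i, (if i ∈ S then 1 / (n : ℝ) else 0) = 1 := by
    rw [Finset.sum_ite_mem, Finset.univ_inter, Finset.sum_const, hS, nsmul_eq_mul]
    field_simp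
  have hSh : ∑ i, (if i ∈ S then 1 / (n : ℝ) else 0) * h i = 1 / (n : ℝ) * ∑ i ∈ S, h i := by
    simp only [ite_mul, zero_mul]
    rw [Finset.sum_ite_mem, Finset.univ_inter, Finset.mul_sum]
  have hle : ∑ i, (ξ i - if i ∈ S then 1 / (n : ℝ) else 0) * (h i - h k) ≤ 0 := by
    refine Finset.sum_nonpos fun i _ => ?_
    split_ifs with hi
    · exact mul_nonpos_of_nonpos_of_nonneg (sub_nonpos.2 (hξ i).2) (sub_nonneg.2 (hk i hi))
    · rw [sub_zero]
      exact mul_nonpos_of_nonneg_of_nonpos (hξ i).1 (sub_nonpos.2 (hout i hi))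
  have hexp : ∑ i, (ξ i - if i ∈ S then 1 / (n : ℝ) else 0) * (h i - h k)
      = (∑ i, ξ i * h i - ∑ i, (if i ∈ S then 1 / (n : ℝ) else 0) * h i)
        - (∑ i, ξ i - ∑ i, if i ∈ S then 1 / (n : ℝ) else 0) * h k := by
    rw [← Finset.sum_sub_distrib, ← Finset.sum_sub_distrib, Finset.sum_mul,
      ← Finset.sum_sub_distrib]
    exact Finset.sum_congr rfl fun i _ => by ring
  rw [hexp, hsum, hS1, hSh] at hle
  linarith

namespace Matrix

theorem PosSemidef.mul_mul_transpose_same {m k : Type*} [Fintype m] [Fintype k]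
    {A : Matrix m m ℝ} (hA : A.PosSemidef) (B : Matrix k m ℝ) : (B * A * Bᵀ).PosSemidef := by
  simpa only [conjTranspose_eq_transpose_of_trivial] using hA.mul_mul_conjTranspose_same B

theorem PosSemidef.transpose_mul_mul_same {m k : Type*} [Fintype m] [Fintype k]
    {A : Matrix m m ℝ} (hA : A.PosSemidef) (B : Matrix m k ℝ) : (Bᵀ * A * B).PosSemidef := by
  simpa only [conjTranspose_eq_transpose_of_trivial] using hA.conjTranspose_mul_mul_same B

theorem trace_mul_mul_diagonal_mul {m k R : Type*} [Fintype m] [Fintype k] [DecidableEq m]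
    [CommRing R] (D : Matrix k k R) (A : Matrix k m R) (B : Matrix m k R) (v : m → R) :
    (D * (A * diagonal v * B)).trace = ∑ i, v i * (B * D * A) i i := by
  have : (D * (A * diagonal v * B)).trace = (diagonal v * (B * D * A)).trace := by
    rw [← Matrix.mul_assoc, trace_mul_comm, ← Matrix.mul_assoc, ← Matrix.mul_assoc,
      trace_mul_comm, Matrix.mul_assoc B D A]
  rw [this, trace]
  simp only [diag_apply, diagonal_mul]

section Resolvent

variable {ι : Type*} [Fintype ι] [DecidableEq ι] {M X Y : Matrix ι ι ℝ} {c : ℝ}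

theorem transpose_mul_add_smul_one (hM : M.PosDef) (hX : X.PosSemidef) :
    (X * M + c • 1)ᵀ = M * X + c • 1 := by
  have hM' : Mᵀ = M := hM.isHermitian
  have hX' : Xᵀ = X := hX.isHermitian
  rw [transpose_add, transpose_mul, transpose_smul, transpose_one, hM', hX']

theorem posDef_mul_mul_add_smul_one (hM : M.PosDef) (hX : X.PosSemidef) (hc : 0 < c) :
    (M * (X * M + c • 1)).PosDef := by
  have hM' : Mᵀ = M := hM.isHermitian
  have h1 : (M * X * M).PosSemidef := by simpa only [hM'] using hX.mul_mul_transpose_same M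
  have h2 : M * (X * M + c • 1) = M * X * M + c • M := by
    rw [Matrix.mul_add, Matrix.mul_assoc, Matrix.mul_smul, Matrix.mul_one]
  rw [h2]
  exact PosDef.posSemidef_add h1 (hM.smul hc)

theorem isUnit_det_mul_add_smul_one (hM : M.PosDef) (hX : X.PosSemidef) (hc : 0 < c) :
    IsUnit (X * M + c • 1).det := by
  have := (posDef_mul_mul_add_smul_one hM hX hc).det_pos
  rw [det_mul] at this
  exact isUnit_iff_ne_zero.2 (right_ne_zero_of_mul this.ne')

theorem inv_mul_add_smul_one_mul_eq_s13 (hM : M.PosDef) (hX : X.PosSemidef) (hc : 0 < c) :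
    (X * M + c • 1)⁻¹ * X = X * ((X * M + c • 1)ᵀ)⁻¹ := by
  have hu := isUnit_det_mul_add_smul_one hM hX hc
  have hu' : IsUnit ((X * M + c • 1)ᵀ).det := by rwa [det_transpose]
  have hcomm : (X * M + c • 1) * X = X * (X * M + c • 1)ᵀ := by
    rw [transpose_mul_add_smul_one hM hX]
    simp [Matrix.add_mul, Matrix.mul_add, Matrix.mul_assoc]
  calc (X * M + c • 1)⁻¹ * X
      = (X * M + c • 1)⁻¹ * (X * (X * M + c • 1)ᵀ) * ((X * M + c • 1)ᵀ)⁻¹ := by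
        rw [Matrix.mul_assoc, mul_nonsing_inv_cancel_right _ _ hu']
    _ = X * ((X * M + c • 1)ᵀ)⁻¹ := by
        rw [← hcomm, nonsing_inv_mul_cancel_left _ _ hu]

theorem posSemidef_inv_mul_add_smul_one_mul (hM : M.PosDef) (hX : X.PosSemidef) (hc : 0 < c) :
    ((X * M + c • 1)⁻¹ * X).PosSemidef := by
  have hM' : Mᵀ = M := hM.isHermitian
  have hX' : Xᵀ = X := hX.isHermitian
  have hu' : IsUnit ((X * M + c • 1)ᵀ).det := by
    rw [det_transpose]; exact isUnit_det_mul_add_smul_one hM hX hc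
  have h1 : (X * (X * M + c • 1)ᵀ).PosSemidef := by
    have h2 : X * (X * M + c • 1)ᵀ = X * M * X + c • X := by
      rw [transpose_mul_add_smul_one hM hX, Matrix.mul_add, Matrix.mul_assoc, Matrix.mul_smul,
        Matrix.mul_one]
    have h3 : (X * M * X).PosSemidef := by
      simpa only [hX'] using hM.posSemidef.mul_mul_transpose_same X
    rw [h2]
    exact h3.add (hX.smul hc.le)
  have h4 := h1.mul_mul_transpose_same (X * M + c • 1)⁻¹
  rwa [transpose_nonsing_inv, Matrix.mul_assoc, mul_nonsing_inv_cancel_right _ _ hu'] at h4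

/-- Second resolvent identity for the map `X ↦ (X * M + c • 1)⁻¹ * X`. -/
theorem inv_mul_add_smul_one_mul_sub (hM : M.PosDef) (hX : X.PosSemidef) (hY : Y.PosSemidef)
    (hc : 0 < c) :
    (Y * M + c • 1)⁻¹ * Y - (X * M + c • 1)⁻¹ * X
      = c • ((X * M + c • 1)⁻¹ * (Y - X) * ((Y * M + c • 1)ᵀ)⁻¹) := by
  have hu := isUnit_det_mul_add_smul_one hM hX hc
  have hu' : IsUnit ((Y * M + c • 1)ᵀ).det := by
    rw [det_transpose]; exact isUnit_det_mul_add_smul_one hM hY hc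
  have hkey : (X * M + c • 1) * Y - X * (Y * M + c • 1)ᵀ = c • (Y - X) := by
    rw [transpose_mul_add_smul_one hM hY]
    simp [Matrix.add_mul, Matrix.mul_add, Matrix.mul_assoc, smul_sub]
  rw [inv_mul_add_smul_one_mul_eq_s13 hM hY hc, ← Matrix.smul_mul, ← Matrix.mul_smul, ← hkey,
    Matrix.mul_sub, Matrix.sub_mul, nonsing_inv_mul_cancel_left _ _ hu, ← Matrix.mul_assoc,
    mul_nonsing_inv_cancel_right _ _ hu']

/-- The map `X ↦ (X * M + c • 1)⁻¹ * X` lies below its linearization in the Löwner order. -/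
theorem posSemidef_linearization_sub (hM : M.PosDef) (hX : X.PosSemidef) (hY : Y.PosSemidef)
    (hc : 0 < c) :
    (c • ((X * M + c • 1)⁻¹ * (Y - X) * ((X * M + c • 1)ᵀ)⁻¹)
      - ((Y * M + c • 1)⁻¹ * Y - (X * M + c • 1)⁻¹ * X)).PosSemidef := by
  have hX' : Xᵀ = X := hX.isHermitian
  have hY' : Yᵀ = Y := hY.isHermitian
  have huX : IsUnit ((X * M + c • 1)ᵀ).det := by
    rw [det_transpose]; exact isUnit_det_mul_add_smul_one hM hX hc
  have huY := isUnit_det_mul_add_smul_one hM hY hc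
  have huY' : IsUnit ((Y * M + c • 1)ᵀ).det := by rwa [det_transpose]
  have hres : ((X * M + c • 1)ᵀ)⁻¹ - ((Y * M + c • 1)ᵀ)⁻¹
      = ((Y * M + c • 1)ᵀ)⁻¹ * M * (Y - X) * ((X * M + c • 1)ᵀ)⁻¹ := by
    have h1 : M * (Y - X) = (Y * M + c • 1)ᵀ - (X * M + c • 1)ᵀ := by
      rw [transpose_mul_add_smul_one hM hX, transpose_mul_add_smul_one hM hY, Matrix.mul_sub]
      abel
    rw [Matrix.mul_assoc _ M, h1, Matrix.mul_sub, Matrix.sub_mul, nonsing_inv_mul _ huY',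
      Matrix.one_mul, mul_nonsing_inv_cancel_right _ _ huX]
  have hmid : (((Y * M + c • 1)ᵀ)⁻¹ * M).PosSemidef := by
    have h1 := (posDef_mul_mul_add_smul_one hM hY hc).posSemidef.transpose_mul_mul_same
      (Y * M + c • 1)⁻¹
    rwa [transpose_nonsing_inv, ← Matrix.mul_assoc, mul_nonsing_inv_cancel_right _ _ huY] at h1
  have hB : ((X * M + c • 1)⁻¹ * (Y - X))ᵀ = (Y - X) * ((X * M + c • 1)ᵀ)⁻¹ := by
    rw [transpose_mul, transpose_sub, hX', hY', transpose_nonsing_inv]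
  have h2 := (hmid.mul_mul_transpose_same ((X * M + c • 1)⁻¹ * (Y - X))).smul hc.le
  rw [hB] at h2
  rw [inv_mul_add_smul_one_mul_sub hM hX hY hc, ← smul_sub, ← Matrix.mul_sub, hres]
  simpa only [Matrix.mul_assoc] using h2

/-- Right derivative of `X ↦ Bᵀ * ((X * M + c • 1)⁻¹ * X) * B` along a segment of positive
semidefinite matrices. -/
theorem hasDerivWithinAt_segment_inv_mul_add_smul_one_mul {k : Type*} [Fintype k]
    (hM : M.PosDef) (hX : X.PosSemidef) (hY : Y.PosSemidef) (hc : 0 < c) (B : Matrix ι k ℝ) :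
    HasDerivWithinAt
      (fun t : ℝ => Bᵀ * (((X + t • (Y - X)) * M + c • 1)⁻¹ * (X + t • (Y - X))) * B)
      (Bᵀ * (c • ((X * M + c • 1)⁻¹ * (Y - X) * ((X * M + c • 1)ᵀ)⁻¹)) * B) (Set.Ioi 0) 0 := by
  have hu' : IsUnit ((X * M + c • 1)ᵀ).det := by
    rw [det_transpose]; exact isUnit_det_mul_add_smul_one hM hX hc
  have hcont : ContinuousAt (fun t : ℝ => (((X + t • (Y - X)) * M + c • 1)ᵀ)⁻¹) 0 := by
    refine ContinuousAt.comp (g := fun A : Matrix ι ι ℝ => A⁻¹) ?_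
      (Continuous.continuousAt (by fun_prop))
    refine continuousAt_matrix_inv _ ?_
    rw [zero_smul, add_zero, Ring.inverse_eq_inv']
    exact continuousAt_inv₀ hu'.ne_zero
  have hg : ContinuousAt (fun t : ℝ => Bᵀ * (c • ((X * M + c • 1)⁻¹ * (Y - X) *
      (((X + t • (Y - X)) * M + c • 1)ᵀ)⁻¹)) * B) 0 := by
    refine ContinuousAt.comp (g := fun A : Matrix ι ι ℝ =>
      Bᵀ * (c • ((X * M + c • 1)⁻¹ * (Y - X) * A)) * B) (Continuous.continuousAt ?_) hcont
    fun_prop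
  have hdiff : ∀ t ∈ Set.Ioo (0 : ℝ) 1,
      Bᵀ * (((X + t • (Y - X)) * M + c • 1)⁻¹ * (X + t • (Y - X))) * B
        - Bᵀ * (((X + (0 : ℝ) • (Y - X)) * M + c • 1)⁻¹ * (X + (0 : ℝ) • (Y - X))) * B
      = t • (Bᵀ * (c • ((X * M + c • 1)⁻¹ * (Y - X) *
          (((X + t • (Y - X)) * M + c • 1)ᵀ)⁻¹)) * B) := by
    intro t ht
    have hXt : (X + t • (Y - X)).PosSemidef := by
      have h1 := (hX.smul (sub_nonneg.2 ht.2.le)).add (hY.smul ht.1.le)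
      rwa [show (1 - t) • X + t • Y = X + t • (Y - X) by module] at h1
    simp only [zero_smul, add_zero]
    rw [← Matrix.sub_mul, ← Matrix.mul_sub, inv_mul_add_smul_one_mul_sub hM hX hXt hc,
      add_sub_cancel_left]
    simp only [Matrix.mul_smul, Matrix.smul_mul]
    rw [smul_comm]
  have hderiv := hasDerivWithinAt_Ioi_zero_of_sub_eq_smul (E := Matrix k k ℝ) hg hdiff
  simp only [zero_smul, add_zero] at hderiv
  exact hderiv

end Resolvent

end Matrix

/-- **Theorem 2** (equivalence theorem): `ξ̄ ∈ Ξ` maximizes `Φ ∘ L` over `Ξ` if and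
only if for every subset `S ⊆ {1,…,N}` of cardinality `n` (an exact `n`-point
design) one has `(1/n) ∑_{i ∈ S} h i ≤ ∑_i ξ̄ i * h i`, where
`h i = ((Z(ξ̄)ᵀ)⁻¹ F D Fᵀ Z(ξ̄)⁻¹) i i` and `D` is the gradient of `Φ` at `L ξ̄`. -/
theorem stmt_13 (N n p : ℕ) (hN : 0 < N) (hn : 0 < n) (hp : 0 < p) (hnN : n ≤ N)
    (C : Matrix (Fin N) (Fin N) ℝ) (hC : C.PosDef)
    (κ : ℝ) (hκ : 0 < κ)
    (hCκ : (C - κ • (1 : Matrix (Fin N) (Fin N) ℝ)).PosDef)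
    (F : Matrix (Fin N) (Fin p) ℝ)
    (Z : (Fin N → ℝ) → Matrix (Fin N) (Fin N) ℝ)
    (hZ : ∀ ξ, Z ξ = Matrix.diagonal ξ * (C - κ • 1) + (κ / (n : ℝ)) • 1)
    (L : (Fin N → ℝ) → Matrix (Fin p) (Fin p) ℝ)
    (hL : ∀ ξ, L ξ = Fᵀ * (Z ξ)⁻¹ * Matrix.diagonal ξ * F)
    (Ξ : Set (Fin N → ℝ))
    (hΞ : Ξ = {ξ : Fin N → ℝ | ∑ i, ξ i = 1 ∧ ∀ i, 0 ≤ ξ i ∧ ξ i ≤ 1 / (n : ℝ)})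
    (ξbar : Fin N → ℝ) (hξbar : ξbar ∈ Ξ)
    (Φ : Matrix (Fin p) (Fin p) ℝ → ℝ)
    (hΦconc : ConcaveOn ℝ {A : Matrix (Fin p) (Fin p) ℝ | A.PosSemidef} Φ)
    (hΦmono : ∀ A B : Matrix (Fin p) (Fin p) ℝ, (B - A).PosSemidef → Φ A ≤ Φ B)
    (D : Matrix (Fin p) (Fin p) ℝ) (hDsymm : Dᵀ = D)
    (ψ : Matrix (Fin p) (Fin p) ℝ →L[ℝ] ℝ)
    (hψ : ∀ A : Matrix (Fin p) (Fin p) ℝ, ψ A = (D * A).trace)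
    (hdiff : HasFDerivAt Φ ψ (L ξbar))
    (h : Fin N → ℝ)
    (hh : ∀ i, h i = (((Z ξbar)ᵀ)⁻¹ * F * D * Fᵀ * (Z ξbar)⁻¹) i i) :
    (∀ ξ ∈ Ξ, Φ (L ξ) ≤ Φ (L ξbar)) ↔
      ∀ S : Finset (Fin N), S.card = n →
        (1 / (n : ℝ)) * ∑ i ∈ S, h i ≤ ∑ i, ξbar i * h i := by
  have hn0 : (0 : ℝ) < n := Nat.cast_pos.2 hn
  set c : ℝ := κ / n with hc_def
  have hc : 0 < c := div_pos hκ hn0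
  set M : Matrix (Fin N) (Fin N) ℝ := C - κ • 1 with hM_def
  set X : Matrix (Fin N) (Fin N) ℝ := diagonal ξbar with hX_def
  have hpsd : ∀ ξ ∈ Ξ, (diagonal ξ).PosSemidef := by
    intro ξ hξ
    rw [hΞ] at hξ
    exact PosSemidef.diagonal fun i => (hξ.2 i).1
  have hL' : ∀ ξ, L ξ = Fᵀ * ((diagonal ξ * M + c • 1)⁻¹ * diagonal ξ) * F := fun ξ => by
    rw [hL, hZ, Matrix.mul_assoc Fᵀ]
  have hX : X.PosSemidef := hpsd ξbar hξbar
  have hLpsd : ∀ ξ ∈ Ξ, (L ξ).PosSemidef := fun ξ hξ => by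
    rw [hL']
    exact (posSemidef_inv_mul_add_smul_one_mul hCκ (hpsd ξ hξ) hc).transpose_mul_mul_same F
  have hψlin : ∀ ξ : Fin N → ℝ,
      ψ (Fᵀ * (c • ((X * M + c • 1)⁻¹ * (diagonal ξ - X) * ((X * M + c • 1)ᵀ)⁻¹)) * F)
        = c * (∑ i, ξ i * h i - ∑ i, ξbar i * h i) := by
    intro ξ
    have h1 : Fᵀ * ((X * M + c • 1)⁻¹ * (diagonal ξ - X) * ((X * M + c • 1)ᵀ)⁻¹) * F
        = Fᵀ * (Z ξbar)⁻¹ * diagonal (fun i => ξ i - ξbar i) * (((Z ξbar)ᵀ)⁻¹ * F) := by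
      rw [hZ, ← diagonal_sub]
      simp only [Matrix.mul_assoc, hX_def]
    rw [Matrix.mul_smul, Matrix.smul_mul, map_smul, smul_eq_mul, hψ, h1,
      trace_mul_mul_diagonal_mul, ← Finset.sum_sub_distrib]
    congr 1
    refine Finset.sum_congr rfl fun i _ => ?_
    rw [hh, ← sub_mul, ← Matrix.mul_assoc]
  have hψnonneg : ∀ P : Matrix (Fin p) (Fin p) ℝ, P.PosSemidef → 0 ≤ ψ P := by
    intro P hP
    refine (hdiff.hasDerivAt_line P).hasDerivWithinAt.nonneg_of_forall_Icc_le fun t ht => ?_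
    refine hΦmono _ _ ?_
    rw [zero_smul, add_zero, add_sub_cancel_left]
    exact hP.smul ht.1
  constructor
  · intro hmax S hS
    set ξS : Fin N → ℝ := fun i => if i ∈ S then 1 / (n : ℝ) else 0 with hξS_def
    have hξS : ξS ∈ Ξ := by
      rw [hΞ]
      refine ⟨?_, fun i => ?_⟩
      · rw [hξS_def, Finset.sum_ite_mem, Finset.univ_inter, Finset.sum_const, hS, nsmul_eq_mul]
        field_simp
      · simp only [hξS_def]
        split_ifs
        · exact ⟨by positivity, le_rfl⟩
        · exact ⟨le_rfl, by positivity⟩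
    have hsum : ∑ i, ξS i * h i = 1 / (n : ℝ) * ∑ i ∈ S, h i := by
      simp only [hξS_def, ite_mul, zero_mul]
      rw [Finset.sum_ite_mem, Finset.univ_inter, Finset.mul_sum]
    have hconv : Convex ℝ Ξ := by
      rw [hΞ]
      rintro x ⟨hx1, hx⟩ y ⟨hy1, hy⟩ a b ha hb hab
      refine ⟨?_, fun i => ?_⟩
      · simp only [Pi.add_apply, Pi.smul_apply, smul_eq_mul, Finset.sum_add_distrib,
          ← Finset.mul_sum, hx1, hy1, mul_one, hab]
      · exact convex_Icc (0 : ℝ) (1 / (n : ℝ)) (hx i) (hy i) ha hb hab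
    have hpath : ∀ t : ℝ, diagonal (ξbar + t • (ξS - ξbar)) = X + t • (diagonal ξS - X) := by
      intro t
      ext i j
      by_cases hij : i = j <;> simp [hX_def, hij]
    have hderiv := hasDerivWithinAt_segment_inv_mul_add_smul_one_mul hCκ hX (hpsd _ hξS) hc F
    simp only [← hpath, ← hL'] at hderiv
    have hdiff0 : HasFDerivAt Φ ψ (L (ξbar + (0 : ℝ) • (ξS - ξbar))) := by
      rwa [zero_smul, add_zero]
    have hcomp := (hdiff0.comp_hasDerivWithinAt (0 : ℝ) hderiv).neg
    have hnonneg : 0 ≤ -ψ (Fᵀ * (c • ((X * M + c • 1)⁻¹ * (diagonal ξS - X) *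
        ((X * M + c • 1)ᵀ)⁻¹)) * F) := hcomp.nonneg_of_forall_Icc_le fun t ht => by
      simp only [Function.comp, Pi.neg_apply, zero_smul, add_zero]
      refine neg_le_neg (hmax _ ?_)
      have := hconv hξbar hξS (sub_nonneg.2 ht.2) ht.1 (by ring)
      rwa [show (1 - t) • ξbar + t • ξS = ξbar + t • (ξS - ξbar) by module] at this
    rw [hψlin, hsum] at hnonneg
    have := nonpos_of_mul_nonpos_right (neg_nonneg.1 hnonneg) hc
    linarith
  · intro hS ξ hξ
    have hξ' := hξ
    rw [hΞ] at hξ'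
    obtain ⟨S, hScard, hSle⟩ := exists_card_eq_sum_mul_le hn
      (by rwa [Fintype.card_fin]) hξ'.1 hξ'.2 h
    have hsuper : Φ (L ξ) ≤ Φ (L ξbar) + ψ (L ξ - L ξbar) := hΦconc.le_add_hasFDerivAt (hLpsd _ hξbar) (hLpsd _ hξ) hdiff
    have hgap := hψnonneg _
      ((posSemidef_linearization_sub hCκ hX (hpsd ξ hξ) hc).transpose_mul_mul_same F)
    rw [Matrix.mul_sub, Matrix.sub_mul, map_sub, hψlin, Matrix.mul_sub, Matrix.sub_mul,
      ← hL', ← hL'] at hgap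
    have : c * (∑ i, ξ i * h i - ∑ i, ξbar i * h i) ≤ 0 :=
      mul_nonpos_of_nonneg_of_nonpos hc.le (by linarith [hS S hScard])
    linarith
end

section
/- Let ξ̄, μ ∈ Ξ and suppose Φ is a real-valued function on p×p real matrices that is Fréchet-differentiable at L(ξ̄) with derivative A ↦ trace(D * A) for a p×p matrix D. Then the map α ↦ Φ(L((1−α)·ξ̄ + α·μ)) has right derivative at α = 0 (derivative within [0,∞) at 0) equal to (κ/n) · ∑_{i} (μ(i) − ξ̄(i)) · h(i), where h(i) = ((Z(ξ̄)ᵀ)⁻¹ * F * D * Fᵀ * Z(ξ̄)⁻¹) i i. -/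
open Matrix

attribute [local instance] Matrix.normedAddCommGroup Matrix.normedSpace

/-- If `M` is diagonal with nonnegative entries, `B` is positive definite and `c > 0`, then
`M * B + c • 1` is invertible. -/
theorem isUnit_det_diagonal_mul_add_smul_one {m : Type*} [Fintype m] [DecidableEq m]
    {B : Matrix m m ℝ} (hB : B.PosDef) {d : m → ℝ} (hd : ∀ i, 0 ≤ d i) {c : ℝ} (hc : 0 < c) :
    IsUnit (diagonal d * B + c • (1 : Matrix m m ℝ)).det := by
  rw [isUnit_iff_ne_zero]
  intro h0
  obtain ⟨v, hv, hv0⟩ := exists_vecMul_eq_zero_iff.mpr h0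
  have hcv : (v ᵥ* diagonal d) ᵥ* B + c • v = 0 := by
    simpa [vecMul_add, vecMul_vecMul, vecMul_smul] using hv0
  set w := v ᵥ* diagonal d with hw
  have hsum : w ⬝ᵥ (B *ᵥ w) + c * (v ⬝ᵥ w) = 0 := by
    have := congrArg (fun u => u ⬝ᵥ w) hcv
    simpa [add_dotProduct, smul_dotProduct, dotProduct_mulVec] using this
  have hvw : 0 ≤ v ⬝ᵥ w := by
    refine Finset.sum_nonneg fun i _ => ?_
    rw [hw, vecMul_diagonal]
    nlinarith [mul_nonneg (hd i) (mul_self_nonneg (v i))]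
  by_cases hw0 : w = 0
  · rw [hw0, zero_vecMul, zero_add] at hcv
    exact hv ((smul_eq_zero.mp hcv).resolve_left hc.ne')
  · have hpos : 0 < w ⬝ᵥ (B *ᵥ w) := by
      simpa using hB.dotProduct_mulVec_pos hw0
    nlinarith [mul_nonneg hc.le hvw]

/-- Exact difference formula for `M ↦ (M * B + c • 1)⁻¹ * M`. -/
theorem inv_mul_sub_inv_mul {m : Type*} [Fintype m] [DecidableEq m]
    {B M M' : Matrix m m ℝ} {c : ℝ}
    (h : IsUnit (M * B + c • (1 : Matrix m m ℝ)).det)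
    (h' : IsUnit (M' * B + c • (1 : Matrix m m ℝ)).det)
    (ht : IsUnit (B * M + c • (1 : Matrix m m ℝ)).det) :
    (M' * B + c • (1 : Matrix m m ℝ))⁻¹ * M' - (M * B + c • (1 : Matrix m m ℝ))⁻¹ * M =
      c • ((M' * B + c • (1 : Matrix m m ℝ))⁻¹ * (M' - M) *
        (B * M + c • (1 : Matrix m m ℝ))⁻¹) := by
  have hcomm : (M * B + c • (1 : Matrix m m ℝ))⁻¹ * M =
      M * (B * M + c • (1 : Matrix m m ℝ))⁻¹ := by
    have e : M * (B * M + c • (1 : Matrix m m ℝ)) = (M * B + c • (1 : Matrix m m ℝ)) * M := by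
      simp [mul_add, add_mul, mul_assoc]
    calc _ = (M * B + c • (1 : Matrix m m ℝ))⁻¹ * (M * (B * M + c • (1 : Matrix m m ℝ))) *
          (B * M + c • (1 : Matrix m m ℝ))⁻¹ := by
            rw [← mul_assoc, mul_nonsing_inv_cancel_right _ _ ht]
      _ = _ := by rw [e, nonsing_inv_mul_cancel_left _ _ h]
  have e : c • (M' - M) = M' * (B * M + c • (1 : Matrix m m ℝ)) -
      (M' * B + c • (1 : Matrix m m ℝ)) * M := by
    simp [mul_add, add_mul, mul_assoc, smul_sub]
  rw [hcomm, ← smul_mul_assoc, ← mul_smul_comm, e, mul_sub, sub_mul,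
    nonsing_inv_mul_cancel_left _ _ h', ← mul_assoc, mul_nonsing_inv_cancel_right _ _ ht]

/-- Matrix inversion is continuous along a continuous family at an invertible value. -/
theorem continuousAt_nonsing_inv {m X : Type*} [Fintype m] [DecidableEq m] [TopologicalSpace X]
    {A : X → Matrix m m ℝ} (hA : Continuous A) {x : X} (hx : IsUnit (A x).det) :
    ContinuousAt (fun y => (A y)⁻¹) x := by
  simp only [inv_def, Ring.inverse_eq_inv']
  exact (hA.matrix_det.continuousAt.inv₀ hx.ne_zero).smul hA.matrix_adjugate.continuousAt

/-- The trace of a product with a diagonal factor is a weighted sum of diagonal entries. -/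
theorem trace_mul_diagonal_mul {m k : Type*} [Fintype m] [DecidableEq m] [Fintype k]
    (P : Matrix k m ℝ) (d : m → ℝ) (Q : Matrix m k ℝ) :
    (P * diagonal d * Q).trace = ∑ i, d i * (Q * P) i i := by
  rw [Matrix.mul_assoc, trace_mul_comm, Matrix.mul_assoc]
  simp [trace, diagonal_mul]

/-- Directional-derivative formula from the proof of **Theorem 2**: for
`ξ̄, μ ∈ Ξ` and `Φ` Fréchet-differentiable at `L ξ̄` with derivative
`A ↦ trace (D * A)`, the map `α ↦ Φ (L ((1-α)•ξ̄ + α•μ))` has right derivative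
at `α = 0` equal to `(κ/n) ∑_i (μ i - ξ̄ i) * h i`, where
`h i = ((Z(ξ̄)ᵀ)⁻¹ F D Fᵀ Z(ξ̄)⁻¹) i i`. -/
theorem stmt_15 (N n p : ℕ) (hN : 0 < N) (hn : 0 < n) (hp : 0 < p)
    (C : Matrix (Fin N) (Fin N) ℝ) (hC : C.PosDef)
    (κ : ℝ) (hκ : 0 < κ)
    (hCκ : (C - κ • (1 : Matrix (Fin N) (Fin N) ℝ)).PosDef)
    (F : Matrix (Fin N) (Fin p) ℝ)
    (Z : (Fin N → ℝ) → Matrix (Fin N) (Fin N) ℝ)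
    (hZ : ∀ ξ, Z ξ = Matrix.diagonal ξ * (C - κ • 1) + (κ / (n : ℝ)) • 1)
    (L : (Fin N → ℝ) → Matrix (Fin p) (Fin p) ℝ)
    (hL : ∀ ξ, L ξ = Fᵀ * (Z ξ)⁻¹ * Matrix.diagonal ξ * F)
    (ξbar μ : Fin N → ℝ)
    (hξbar : (∑ i, ξbar i = 1) ∧ ∀ i, 0 ≤ ξbar i ∧ ξbar i ≤ 1 / (n : ℝ))
    (hμ : (∑ i, μ i = 1) ∧ ∀ i, 0 ≤ μ i ∧ μ i ≤ 1 / (n : ℝ))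
    (Φ : Matrix (Fin p) (Fin p) ℝ → ℝ)
    (D : Matrix (Fin p) (Fin p) ℝ)
    (ψ : Matrix (Fin p) (Fin p) ℝ →L[ℝ] ℝ)
    (hψ : ∀ A : Matrix (Fin p) (Fin p) ℝ, ψ A = (D * A).trace)
    (hdiff : HasFDerivAt Φ ψ (L ξbar))
    (h : Fin N → ℝ)
    (hh : ∀ i, h i = (((Z ξbar)ᵀ)⁻¹ * F * D * Fᵀ * (Z ξbar)⁻¹) i i) :
    HasDerivWithinAt (fun α : ℝ => Φ (L ((1 - α) • ξbar + α • μ)))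
      ((κ / (n : ℝ)) * ∑ i, (μ i - ξbar i) * h i)
      (Set.Ici (0 : ℝ)) 0 := by
  have hc : 0 < κ / (n : ℝ) := div_pos hκ (by exact_mod_cast hn)
  set c := κ / (n : ℝ)
  set B := C - κ • (1 : Matrix (Fin N) (Fin N) ℝ)
  have hBt : Bᵀ = B := by simpa using hCκ.isHermitian.eq
  have hZt : (Z ξbar)ᵀ = B * diagonal ξbar + c • 1 := by
    rw [hZ]; simp [transpose_mul, hBt]
  have hU : IsUnit (Z ξbar).det := by
    rw [hZ]
    exact isUnit_det_diagonal_mul_add_smul_one hCκ (fun i => (hξbar.2 i).1) hc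
  have hUt : IsUnit ((Z ξbar)ᵀ).det := by rwa [det_transpose]
  set γ : ℝ → Fin N → ℝ := fun α => (1 - α) • ξbar + α • μ with hγ
  have hγ0 : γ 0 = ξbar := by simp [hγ]
  have hγsub : ∀ α, diagonal (γ α) - diagonal ξbar = α • diagonal (μ - ξbar) := by
    intro α
    rw [diagonal_sub, ← diagonal_smul]
    congr 1
    ext i
    simp [hγ]
    ring
  have hZcont : Continuous fun α => Z (γ α) := by
    simp only [hZ, hγ]
    fun_prop
  have hU0 : IsUnit (Z (γ 0)).det := by rwa [hγ0]
  let G : ℝ → Matrix (Fin p) (Fin p) ℝ := fun α =>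
    c • (Fᵀ * ((Z (γ α))⁻¹ * diagonal (μ - ξbar) * ((Z ξbar)ᵀ)⁻¹) * F)
  have hG : ContinuousAt G 0 := by
    have := continuousAt_nonsing_inv hZcont hU0
    have hlin : Continuous fun X : Matrix (Fin N) (Fin N) ℝ =>
        c • (Fᵀ * (X * diagonal (μ - ξbar) * ((Z ξbar)ᵀ)⁻¹) * F) := by fun_prop
    exact hlin.continuousAt.comp this
  have hdiffL : ∀ α, IsUnit (Z (γ α)).det → L (γ α) - L ξbar = α • G α := by
    intro α hα
    have key := inv_mul_sub_inv_mul (B := B) (M := diagonal ξbar) (M' := diagonal (γ α)) (c := c)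
      (by rwa [← hZ]) (by rwa [← hZ]) (by rwa [← hZt])
    rw [← hZ, ← hZ, ← hZt, hγsub] at key
    have : L (γ α) - L ξbar =
        Fᵀ * ((Z (γ α))⁻¹ * diagonal (γ α) - (Z ξbar)⁻¹ * diagonal ξbar) * F := by
      rw [hL, hL, Matrix.mul_sub, Matrix.sub_mul]
      simp only [Matrix.mul_assoc]
    rw [this, key]
    simp only [G, Matrix.mul_smul, Matrix.smul_mul]
    rw [smul_comm]
  have hLderiv : HasDerivAt (fun α => L (γ α)) (G 0) 0 := by
    refine hasDerivAt_iff_tendsto_slope.mpr ?_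
    refine (hG.tendsto.mono_left nhdsWithin_le_nhds).congr' ?_
    have hev : ∀ᶠ α in nhds (0 : ℝ), (Z (γ α)).det ≠ 0 :=
      hZcont.matrix_det.continuousAt.eventually_ne hU0.ne_zero
    filter_upwards [hev.filter_mono nhdsWithin_le_nhds, self_mem_nhdsWithin] with α hα hne
    rw [slope_def_module, hγ0, hdiffL α (isUnit_iff_ne_zero.mpr hα), sub_zero,
      inv_smul_smul₀ hne]
  have hval : ψ (G 0) = c * ∑ i, (μ i - ξbar i) * h i := by
    rw [hψ]
    simp only [G, hγ0, Matrix.mul_smul, trace_smul, smul_eq_mul]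
    congr 1
    have := trace_mul_diagonal_mul (D * Fᵀ * (Z ξbar)⁻¹) (μ - ξbar) (((Z ξbar)ᵀ)⁻¹ * F)
    simp only [hh, Pi.sub_apply, Matrix.mul_assoc] at this ⊢
    exact this
  rw [← hval]
  rw [← hγ0] at hdiff
  exact (hdiff.comp_hasDerivAt (0 : ℝ) hLderiv).hasDerivWithinAt
end

section
/- Let 1 ≤ n ≤ N. The set Ξ = {ξ : Fin N → ℝ | ∑ i, ξ i = 1 and 0 ≤ ξ i ≤ 1/n for every i} equals the convex hull in (Fin N → ℝ) of the set of exact n-point designs, i.e., of the vectors ξ_S with ξ_S(i) = 1/n for i ∈ S and ξ_S(i) = 0 otherwise, where S ranges over subsets of Fin N of cardinality n. -/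
/-- An extreme point of a capped simplex has at most one coordinate strictly between the bounds. -/
theorem eq_of_mem_extremePoints_cappedSimplex {ι : Type*} [Fintype ι] {c s : ℝ} {x : ι → ℝ}
    (hx : x ∈ Set.extremePoints ℝ {ξ : ι → ℝ | ∑ i, ξ i = s ∧ ∀ i, 0 ≤ ξ i ∧ ξ i ≤ c}) {i j : ι}
    (hi : 0 < x i ∧ x i < c) (hj : 0 < x j ∧ x j < c) : i = j := by
  classical
  by_contra hij
  obtain ⟨⟨hsum, hbd⟩, hext⟩ := mem_extremePoints_iff_left.1 hx
  obtain ⟨ε, hε, hεle⟩ : ∃ ε > 0, ε ≤ x i ∧ ε ≤ c - x i ∧ ε ≤ x j ∧ ε ≤ c - x j := by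
    refine ⟨min (min (x i) (c - x i)) (min (x j) (c - x j)), ?_, ?_⟩
    · simp [hi, hj]
    · simp
  have mem (t : ℝ) (ht : |t| ≤ ε) : x + t • (Pi.single i 1 - Pi.single j 1) ∈
      {ξ : ι → ℝ | ∑ i, ξ i = s ∧ ∀ i, 0 ≤ ξ i ∧ ξ i ≤ c} := by
    obtain ⟨h₁, h₂⟩ := abs_le.1 ht
    refine ⟨by simp [Finset.sum_add_distrib, ← Finset.mul_sum, hsum], fun k => ?_⟩
    by_cases hki : k = i
    · subst hki
      simp only [Pi.add_apply, Pi.smul_apply, Pi.sub_apply, Pi.single_eq_same,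
        Pi.single_eq_of_ne hij, smul_eq_mul]
      constructor <;> linarith
    by_cases hkj : k = j
    · subst hkj
      simp only [Pi.add_apply, Pi.smul_apply, Pi.sub_apply, Pi.single_eq_same,
        Pi.single_eq_of_ne hki, smul_eq_mul]
      constructor <;> linarith
    · simpa [hki, hkj] using hbd k
  have h := hext _ (mem ε (abs_of_pos hε).le) _ (mem (-ε) (by simp [abs_of_pos hε]))
    ⟨1 / 2, 1 / 2, by norm_num, by norm_num, by norm_num, by module⟩
  have := congrFun h i
  simp [Pi.single_eq_of_ne hij] at this
  exact hε.ne' this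

/-- The extreme points of the simplex with coordinates capped at `1 / n` are uniform on
`n`-element sets. -/
theorem exists_finset_of_mem_extremePoints_cappedSimplex {ι : Type*} [Fintype ι] [DecidableEq ι]
    {n : ℕ} (hn : 1 ≤ n) {x : ι → ℝ} (hx : x ∈ Set.extremePoints ℝ
      {ξ : ι → ℝ | ∑ i, ξ i = 1 ∧ ∀ i, 0 ≤ ξ i ∧ ξ i ≤ 1 / (n : ℝ)}) :
    ∃ S : Finset ι, S.card = n ∧ x = fun i => if i ∈ S then 1 / (n : ℝ) else 0 := by
  obtain ⟨hsum, hbd⟩ := hx.1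
  have hn0 : (0 : ℝ) < n := by exact_mod_cast hn
  set S : Finset ι := {i | x i = 1 / (n : ℝ)} with hS
  have hout (i : ι) (hi : ¬ (0 < x i ∧ x i < 1 / (n : ℝ))) :
      x i = if i ∈ S then 1 / (n : ℝ) else 0 := by
    simp only [hS, Finset.mem_filter, Finset.mem_univ, true_and]
    split_ifs with h
    · exact h
    · by_contra h0
      exact hi ⟨(hbd i).1.lt_of_ne' h0, (hbd i).2.lt_of_ne h⟩
  have hconst : ∑ i, (if i ∈ S then 1 / (n : ℝ) else 0) = S.card * (1 / (n : ℝ)) := by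
    simp
  have hnofrac (k : ι) : ¬ (0 < x k ∧ x k < 1 / (n : ℝ)) := by
    intro hk
    have hkS : k ∉ S := by simp only [hS, Finset.mem_filter, not_and]; exact fun _ => hk.2.ne
    have hdiff : ∑ i, (x i - if i ∈ S then 1 / (n : ℝ) else 0) = x k := by
      rw [Finset.sum_eq_single k]
      · simp [hkS]
      · intro i _ hik
        exact sub_eq_zero.2 (hout i fun hi => hik (eq_of_mem_extremePoints_cappedSimplex hx hi hk))
      · simp
    rw [Finset.sum_sub_distrib, hsum, hconst] at hdiff
    have hxk : (n : ℝ) * x k = n - S.card := by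
      rw [← hdiff]; field_simp
    have h₁ : (S.card : ℝ) < n := by nlinarith [mul_pos hn0 hk.1]
    have h₂ : (n : ℝ) < S.card + 1 := by
      have := (lt_div_iff₀' hn0).1 hk.2
      linarith
    norm_cast at h₁ h₂
    omega
  have hxS : x = fun i => if i ∈ S then 1 / (n : ℝ) else 0 := funext fun i => hout i (hnofrac i)
  refine ⟨S, ?_, hxS⟩
  have h : (S.card : ℝ) * (1 / (n : ℝ)) = 1 := by
    exact hconst.symm.trans <|
      (Finset.sum_congr rfl fun i _ => (hout i (hnofrac i)).symm).trans hsum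
  rw [mul_one_div, div_eq_one_iff_eq hn0.ne'] at h
  exact_mod_cast h

theorem isCompact_cappedSimplex {ι : Type*} [Fintype ι] (c s : ℝ) :
    IsCompact {ξ : ι → ℝ | ∑ i, ξ i = s ∧ ∀ i, 0 ≤ ξ i ∧ ξ i ≤ c} := by
  have hbox : IsCompact (Set.univ.pi fun _ : ι => Set.Icc 0 c) :=
    isCompact_univ_pi fun _ => isCompact_Icc
  convert hbox.inter_left (isClosed_eq (f := fun ξ : ι → ℝ => ∑ i, ξ i) (g := fun _ => s)
    (by fun_prop) continuous_const) using 1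
  ext ξ
  simp only [Set.mem_inter_iff, Set.mem_ofPred_eq, Set.mem_univ_pi, Set.mem_Icc]

theorem convex_cappedSimplex {ι : Type*} [Fintype ι] (c s : ℝ) :
    Convex ℝ {ξ : ι → ℝ | ∑ i, ξ i = s ∧ ∀ i, 0 ≤ ξ i ∧ ξ i ≤ c} := by
  rintro x ⟨hx, hx'⟩ y ⟨hy, hy'⟩ a b ha hb hab
  refine ⟨?_, fun i => convex_Icc 0 c (hx' i) (hy' i) ha hb hab⟩
  simp [Finset.sum_add_distrib, ← Finset.mul_sum, hx, hy, ← add_mul, hab]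


/-- The set `Ξ` of design measures is the convex hull of the exact `n`-point
designs, i.e. of the uniform measures putting mass `1/n` on each point of a
subset `S ⊆ {1,…,N}` of cardinality `n` (Section 2.3 of the paper). -/
theorem stmt_16 (N n : ℕ) (hn : 1 ≤ n) (hnN : n ≤ N) :
    {ξ : Fin N → ℝ | ∑ i, ξ i = 1 ∧ ∀ i, 0 ≤ ξ i ∧ ξ i ≤ 1 / (n : ℝ)} =
      convexHull ℝ
        {ξ : Fin N → ℝ | ∃ S : Finset (Fin N), S.card = n ∧
          ξ = fun i => if i ∈ S then 1 / (n : ℝ) else 0} := by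
  have hn0 : (n : ℝ) ≠ 0 := by exact_mod_cast (by omega : n ≠ 0)
  refine Set.Subset.antisymm ?_ (convexHull_min ?_ (convex_cappedSimplex _ _))
  · have hfin : {ξ : Fin N → ℝ | ∃ S : Finset (Fin N), S.card = n ∧
          ξ = fun i => if i ∈ S then 1 / (n : ℝ) else 0}.Finite :=
      (Set.finite_range fun (S : Finset (Fin N)) i => if i ∈ S then 1 / (n : ℝ) else 0).subset
        fun _ ⟨S, _, hξ⟩ => ⟨S, hξ.symm⟩
    rw [← closure_convexHull_extremePoints (isCompact_cappedSimplex _ _)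
      (convex_cappedSimplex _ _)]
    exact closure_minimal
      (convexHull_mono fun _ hx => exists_finset_of_mem_extremePoints_cappedSimplex hn hx)
      (hfin.isClosed_convexHull ℝ)
  · rintro _ ⟨S, hS, rfl⟩
    refine ⟨by simp [hS, hn0], fun i => ?_⟩
    dsimp only
    split_ifs
    · exact ⟨by positivity, le_rfl⟩
    · exact ⟨le_rfl, by positivity⟩
end
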